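/- A closed C(X)-submodule Z of F is essential if and only if for every ρ ∈ F there exists an open dense subset U_ρ ⊆ X such that gρ ∈ Z for every continuous function g : X → ℂ vanishing on X ∖ U_ρ. -/

import Mathlib

open ContinuousMap

variable {X : Type*} [TopologicalSpace X] [CompactSpace X] [T2Space X]
  [ExtremallyDisconnected X]
variable {H : Type*} [NormedAddCommGroup H] [InnerProductSpace ℂ H] [CompleteSpace H]
  [TopologicalSpace.SeparableSpace H]

/-- A closed `C(X)`-submodule `Z` of `F = C(X, H)` is essential if it has nonzero
intersection with every nonzero closed `C(X)`-submodule of `F`. -/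
def IsEssentialSubmodule (Z : Submodule C(X, ℂ) C(X, H)) : Prop :=
  ∀ W : Submodule C(X, ℂ) C(X, H), IsClosed (W : Set C(X, H)) → W ≠ ⊥ → Z ⊓ W ≠ ⊥

theorem exists_continuousMap_eq_one_of_mem_isOpen {Y : Type*} [TopologicalSpace Y] [CompactSpace Y]
    [T2Space Y] {V : Set Y} (hV : IsOpen V) {x : Y} (hx : x ∈ V) :
    ∃ g : C(Y, ℂ), g x = 1 ∧ ∀ t, t ∉ V → g t = 0 := by
  obtain ⟨f, hf0, hf1, -⟩ := exists_continuous_zero_one_of_isClosed hV.isClosed_compl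
    (isClosed_singleton (x := x)) (by simpa using hx)
  refine ⟨⟨fun t => (f t : ℂ), by fun_prop⟩, ?_, fun t ht => ?_⟩
  · simpa using hf1 rfl
  · simpa using hf0 ht

/-- The ideal of all `g` with `g • ρ ∈ Z`. -/
noncomputable def smulMemIdeal {Y E : Type*} [TopologicalSpace Y] [NormedAddCommGroup E] [InnerProductSpace ℂ E]
    (Z : Submodule C(Y, ℂ) C(Y, E)) (ρ : C(Y, E)) : Ideal C(Y, ℂ) :=
  Z.comap (LinearMap.toSpanSingleton C(Y, ℂ) C(Y, E) ρ)

theorem mem_smulMemIdeal {Y E : Type*} [TopologicalSpace Y] [NormedAddCommGroup E]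
    [InnerProductSpace ℂ E] {Z : Submodule C(Y, ℂ) C(Y, E)} {ρ : C(Y, E)} {g : C(Y, ℂ)} :
    g ∈ smulMemIdeal Z ρ ↔ g • ρ ∈ Z := Iff.rfl

theorem isClosed_smulMemIdeal {Y E : Type*} [TopologicalSpace Y] [CompactSpace Y] [T2Space Y]
    [NormedAddCommGroup E] [InnerProductSpace ℂ E] {Z : Submodule C(Y, ℂ) C(Y, E)}
    (hZ : IsClosed (Z : Set C(Y, E))) (ρ : C(Y, E)) :
    IsClosed (smulMemIdeal Z ρ : Set C(Y, ℂ)) := by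
  have hcont : Continuous fun g : C(Y, ℂ) => g • ρ :=
    ContinuousMap.continuous_of_continuous_uncurry _
      (continuous_eval.smul (ρ.continuous.comp continuous_snd))
  exact hZ.preimage hcont

/-- The functions vanishing off `V` that are pointwise proportional to `ρ` wherever `ρ ≠ 0`. -/
def proportionalSubmodule {Y E : Type*} [TopologicalSpace Y] [NormedAddCommGroup E]
    [InnerProductSpace ℂ E] (V : Set Y) (ρ : C(Y, E)) : Submodule C(Y, ℂ) C(Y, E) where
  carrier := {f | (∀ t, t ∉ V → f t = 0) ∧
    ∀ t, inner ℂ (ρ t) (ρ t) • f t = inner ℂ (ρ t) (f t) • ρ t}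
  zero_mem' := by simp
  add_mem' := by
    rintro f g ⟨hf, hf'⟩ ⟨hg, hg'⟩
    refine ⟨fun t ht => by simp [hf t ht, hg t ht], fun t => ?_⟩
    simp only [ContinuousMap.add_apply, smul_add, inner_add_right, add_smul, hf' t, hg' t]
  smul_mem' := by
    rintro c f ⟨hf, hf'⟩
    refine ⟨fun t ht => by simp [hf t ht], fun t => ?_⟩
    simp only [ContinuousMap.smul_apply', inner_smul_right, mul_smul]
    rw [smul_comm, hf' t]

theorem isClosed_proportionalSubmodule {Y E : Type*} [TopologicalSpace Y] [NormedAddCommGroup E]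
    [InnerProductSpace ℂ E] (V : Set Y) (ρ : C(Y, E)) :
    IsClosed (proportionalSubmodule V ρ : Set C(Y, E)) := by
  change IsClosed {f : C(Y, E) | (∀ t, t ∉ V → f t = 0) ∧
    ∀ t, inner ℂ (ρ t) (ρ t) • f t = inner ℂ (ρ t) (f t) • ρ t}
  simp only [Set.ofPred_and, Set.ofPred_forall]
  refine IsClosed.inter ?_ ?_
  · exact isClosed_iInter fun t => isClosed_iInter fun _ =>
      isClosed_eq (continuous_eval_const t) continuous_const
  · refine isClosed_iInter fun t => isClosed_eq ?_ ?_
    · exact (continuous_eval_const t).const_smul _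
    · exact (continuous_const.inner (continuous_eval_const t)).smul continuous_const

theorem smul_mem_proportionalSubmodule {Y E : Type*} [TopologicalSpace Y] [NormedAddCommGroup E]
    [InnerProductSpace ℂ E] {V : Set Y} (ρ : C(Y, E)) {g : C(Y, ℂ)}
    (hg : ∀ t, t ∉ V → g t = 0) : g • ρ ∈ proportionalSubmodule V ρ := by
  refine ⟨fun t ht => by simp [hg t ht], fun t => ?_⟩
  simp only [ContinuousMap.smul_apply', inner_smul_right, smul_smul]
  rw [mul_comm]

theorem IsEssentialSubmodule.dense_setOfIdeal {Y E : Type*} [TopologicalSpace Y] [CompactSpace Y]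
    [T2Space Y] [NormedAddCommGroup E] [InnerProductSpace ℂ E] {Z : Submodule C(Y, ℂ) C(Y, E)}
    (h : IsEssentialSubmodule Z) (ρ : C(Y, E)) :
    Dense (setOfIdeal (smulMemIdeal Z ρ)) := by
  rw [dense_iff_inter_open]
  intro V hV ⟨x, hx⟩
  by_contra hdisj
  have hvanish : ∀ g : C(Y, ℂ), g • ρ ∈ Z → ∀ t ∈ V, g t = 0 := by
    intro g hg t ht
    by_contra hgt
    exact hdisj ⟨t, ht, mem_setOfIdeal.2 ⟨g, mem_smulMemIdeal.2 hg, hgt⟩⟩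
  obtain ⟨y, hyV, hy⟩ : ∃ y ∈ V, ρ y ≠ 0 := by
    by_contra! hρ
    obtain ⟨g, hg1, hg0⟩ := exists_continuousMap_eq_one_of_mem_isOpen hV hx
    have hgρ : g • ρ = 0 := by
      ext t
      by_cases ht : t ∈ V
      · simp [hρ t ht]
      · simp [hg0 t ht]
    exact one_ne_zero (hg1.symm.trans (hvanish g (hgρ ▸ Z.zero_mem) x hx))
  have hV' : IsOpen (V ∩ {t | ρ t ≠ 0}) :=
    hV.inter (isOpen_ne_fun ρ.continuous continuous_const)
  have hne : proportionalSubmodule (V ∩ {t | ρ t ≠ 0}) ρ ≠ ⊥ := by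
    obtain ⟨g, hg1, hg0⟩ := exists_continuousMap_eq_one_of_mem_isOpen hV' ⟨hyV, hy⟩
    intro hbot
    have hmem := smul_mem_proportionalSubmodule ρ hg0
    rw [hbot, Submodule.mem_bot] at hmem
    have := DFunLike.congr_fun hmem y
    simp [hg1, hy] at this
  obtain ⟨f, ⟨hfZ, hf0, hf⟩, hfne⟩ := Submodule.exists_mem_ne_zero_of_ne_bot
    (h _ (isClosed_proportionalSubmodule _ ρ) hne)
  let a : C(Y, ℂ) := ⟨fun t => inner ℂ (ρ t) (ρ t), by fun_prop⟩
  let b : C(Y, ℂ) := ⟨fun t => inner ℂ (ρ t) (f t), by fun_prop⟩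
  have hab : a • f = b • ρ := by
    ext t
    exact hf t
  have hb := hvanish b (hab ▸ Z.smul_mem a hfZ)
  refine hfne ?_
  ext t
  by_cases ht : t ∈ V ∩ {t | ρ t ≠ 0}
  · have hbt : inner ℂ (ρ t) (f t) = 0 := hb t ht.1
    have hft := hf t
    rw [hbt, zero_smul, smul_eq_zero, inner_self_eq_zero] at hft
    exact hft.resolve_left ht.2
  · exact hf0 t ht

theorem stmt19 (hdim : ¬ FiniteDimensional ℂ H)
    (Z : Submodule C(X, ℂ) C(X, H)) (hZ : IsClosed (Z : Set C(X, H))) :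
    IsEssentialSubmodule Z ↔
      ∀ ρ : C(X, H), ∃ U : Set X, IsOpen U ∧ Dense U ∧
        ∀ g : C(X, ℂ), (∀ t : X, t ∉ U → g t = 0) → g • ρ ∈ Z := by
  constructor
  · intro h ρ
    have hJ : IsClosed (smulMemIdeal Z ρ : Set C(X, ℂ)) :=
      isClosed_smulMemIdeal hZ ρ
    refine ⟨setOfIdeal (smulMemIdeal Z ρ), setOfIdeal_open _, h.dense_setOfIdeal ρ,
      fun g hg => ?_⟩
    have hmem : g ∈ idealOfSet ℂ (setOfIdeal (smulMemIdeal Z ρ)) :=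
      mem_idealOfSet.2 fun t ht => hg t ht
    rwa [idealOfSet_ofIdeal_isClosed hJ, mem_smulMemIdeal] at hmem
  · intro h W _ hW
    obtain ⟨ρ, hρW, hρ⟩ := Submodule.exists_mem_ne_zero_of_ne_bot hW
    obtain ⟨U, hU, hUd, hUZ⟩ := h ρ
    obtain ⟨s, hs⟩ := DFunLike.ne_iff.1 hρ
    obtain ⟨t, ht, htU⟩ := hUd.inter_open_nonempty {t | ρ t ≠ 0}
      (isOpen_ne_fun ρ.continuous continuous_const) ⟨s, hs⟩
    obtain ⟨g, hg1, hg0⟩ := exists_continuousMap_eq_one_of_mem_isOpen hU htU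
    refine (Submodule.ne_bot_iff _).2 ⟨g • ρ, ⟨hUZ g hg0, W.smul_mem g hρW⟩, fun hz => ht ?_⟩
    have := DFunLike.congr_fun hz t
    simpa [hg1] using this
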